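/- The real Koba-Nielsen local zeta function for N = 6, namely Z^(6)(s) = ∫_{ℝ³} ∏_{j=2}^{4} |x_j|^{s_{1j}} |1−x_j|^{s_{5j}} ∏_{2≤i<j≤4} |x_i−x_j|^{s_{ij}} dx₂ dx₃ dx₄, converges and is holomorphic in the nine variables (s₁₂,s₁₃,s₁₄,s₅₂,s₅₃,s₅₄,s₂₃,s₂₄,s₃₄) ∈ ℂ⁹ on the region defined by: Re(s_{ij}) > −1 for all nine ij; Re(s₁₂)+Re(s₁₃)+Re(s₁₄)+Re(s₂₃)+Re(s₂₄)+Re(s₃₄) > −3; Re(s₅₂)+Re(s₅₃)+Re(s₅₄)+Re(s₂₃)+Re(s₂₄)+Re(s₃₄) > −3; Re(s₁₂)+Re(s₁₃)+Re(s₂₃) > −2; Re(s₁₂)+Re(s₁₄)+Re(s₂₄) > −2; Re(s₁₃)+Re(s₁₄)+Re(s₃₄) > −2; Re(s₅₂)+Re(s₅₃)+Re(s₂₃) > −2; Re(s₅₂)+Re(s₅₄)+Re(s₂₄) > −2; Re(s₅₃)+Re(s₅₄)+Re(s₃₄) > −2; Re(s₂₃)+Re(s₂₄)+Re(s₃₄)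 > −2; Re(s₁₂)+Re(s₅₂)+Re(s₂₃)+Re(s₂₄) < −1; Re(s₁₃)+Re(s₅₃)+Re(s₂₃)+Re(s₃₄) < −1; Re(s₁₄)+Re(s₅₄)+Re(s₂₄)+Re(s₃₄) < −1; Re(s₁₂)+Re(s₅₂)+Re(s₁₃)+Re(s₅₃)+Re(s₂₃)+Re(s₂₄)+Re(s₃₄) < −2; Re(s₁₂)+Re(s₅₂)+Re(s₁₄)+Re(s₅₄)+Re(s₂₃)+Re(s₂₄)+Re(s₃₄) < −2; Re(s₁₃)+Re(s₅₃)+Re(s₁₄)+Re(s₅₄)+Re(s₂₃)+Re(s₂₄)+Re(s₃₄) < −2; and the sum of all nine Re(s_{ij}) is < −3. -/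

import Mathlib

open MeasureTheory

/-- The integrand of the real Koba-Nielsen local zeta function `Z^(6)(s)`, in the variables
`x = (x₂, x₃, x₄) ∈ ℝ³` (so `x 0 = x₂`, `x 1 = x₃`, `x 2 = x₄`), with the nine complex
variables indexed as `s 0 = s₁₂`, `s 1 = s₁₃`, `s 2 = s₁₄`, `s 3 = s₅₂`, `s 4 = s₅₃`,
`s 5 = s₅₄`, `s 6 = s₂₃`, `s 7 = s₂₄`, `s 8 = s₃₄`. -/
noncomputable def KN6integrand (s : Fin 9 → ℂ) (x : Fin 3 → ℝ) : ℂ :=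
  ((|x 0| : ℝ) : ℂ) ^ s 0 * ((|x 1| : ℝ) : ℂ) ^ s 1 * ((|x 2| : ℝ) : ℂ) ^ s 2 *
    ((|1 - x 0| : ℝ) : ℂ) ^ s 3 * ((|1 - x 1| : ℝ) : ℂ) ^ s 4 *
    ((|1 - x 2| : ℝ) : ℂ) ^ s 5 *
    ((|x 0 - x 1| : ℝ) : ℂ) ^ s 6 * ((|x 0 - x 2| : ℝ) : ℂ) ^ s 7 *
    ((|x 1 - x 2| : ℝ) : ℂ) ^ s 8

/-- The convergence region for `Z^(6)` from Example 5.5 (with the indexing of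
`KN6integrand`): `s 0 = s₁₂`, `s 1 = s₁₃`, `s 2 = s₁₄`, `s 3 = s₅₂`, `s 4 = s₅₃`,
`s 5 = s₅₄`, `s 6 = s₂₃`, `s 7 = s₂₄`, `s 8 = s₃₄`. -/
def KN6region : Set (Fin 9 → ℂ) :=
  {s | (∀ i, -1 < (s i).re) ∧
       -3 < (s 0).re + (s 1).re + (s 2).re + (s 6).re + (s 7).re + (s 8).re ∧
       -3 < (s 3).re + (s 4).re + (s 5).re + (s 6).re + (s 7).re + (s 8).re ∧
       -2 < (s 0).re + (s 1).re + (s 6).re ∧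
       -2 < (s 0).re + (s 2).re + (s 7).re ∧
       -2 < (s 1).re + (s 2).re + (s 8).re ∧
       -2 < (s 3).re + (s 4).re + (s 6).re ∧
       -2 < (s 3).re + (s 5).re + (s 7).re ∧
       -2 < (s 4).re + (s 5).re + (s 8).re ∧
       -2 < (s 6).re + (s 7).re + (s 8).re ∧
       (s 0).re + (s 3).re + (s 6).re + (s 7).re < -1 ∧
       (s 1).re + (s 4).re + (s 6).re + (s 8).re < -1 ∧
       (s 2).re + (s 5).re + (s 7).re + (s 8).re < -1 ∧
       (s 0).re + (s 3).re + (s 1).re + (s 4).re + (s 6).re + (s 7).re + (s 8).re < -2 ∧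
       (s 0).re + (s 3).re + (s 2).re + (s 5).re + (s 6).re + (s 7).re + (s 8).re < -2 ∧
       (s 1).re + (s 4).re + (s 2).re + (s 5).re + (s 6).re + (s 7).re + (s 8).re < -2 ∧
       (∑ i, (s i).re) < -3}

theorem log_max_combination_le {a b c B₁ B₂ B₃ d p q r : ℝ} (hp : p ≤ 0) (hq : q ≤ 0) (hr : r ≤ 0)
    (ha : d ≤ a) (hb : d ≤ b) (hc : d ≤ c) (hab : 2 * d ≤ a + b + B₁)
    (hbc : 2 * d ≤ b + c + B₂) (habc : 3 * d ≤ a + b + c + B₁ + B₂ + B₃) :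
    a * p + b * q + c * r + B₁ * max p q + B₂ * max q r + B₃ * max p (max q r) ≤
      d * (p + q + r) := by
  rcases le_total p q with h1 | h1 <;> rcases le_total q r with h2 | h2 <;>
    rcases le_total p r with h3 | h3 <;>
    simp only [max_eq_left, max_eq_right, h1, h2, h3]
  · nlinarith [mul_nonneg (sub_nonneg.2 ha) (sub_nonneg.2 h1),
      mul_nonneg (sub_nonneg.2 hab) (sub_nonneg.2 h2),
      mul_nonneg (sub_nonneg.2 habc) (neg_nonneg.2 hr)]
  · nlinarith [mul_nonneg (sub_nonneg.2 ha) (sub_nonneg.2 h1),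
      mul_nonneg (sub_nonneg.2 hab) (sub_nonneg.2 h2),
      mul_nonneg (sub_nonneg.2 habc) (neg_nonneg.2 hr)]
  · nlinarith [mul_nonneg (sub_nonneg.2 ha) (sub_nonneg.2 h3),
      mul_nonneg (add_nonneg (sub_nonneg.2 ha) (sub_nonneg.2 hc)) (sub_nonneg.2 h2),
      mul_nonneg (sub_nonneg.2 habc) (neg_nonneg.2 hq)]
  · nlinarith [mul_nonneg (sub_nonneg.2 hc) (sub_nonneg.2 h3),
      mul_nonneg (add_nonneg (sub_nonneg.2 ha) (sub_nonneg.2 hc)) (sub_nonneg.2 h1),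
      mul_nonneg (sub_nonneg.2 habc) (neg_nonneg.2 hq)]
  · nlinarith [mul_nonneg (sub_nonneg.2 hb) (sub_nonneg.2 h1),
      mul_nonneg (sub_nonneg.2 hab) (sub_nonneg.2 h3),
      mul_nonneg (sub_nonneg.2 habc) (neg_nonneg.2 hr)]
  · nlinarith [mul_nonneg (sub_nonneg.2 hb) (sub_nonneg.2 h2),
      mul_nonneg (sub_nonneg.2 hbc) (sub_nonneg.2 h3),
      mul_nonneg (sub_nonneg.2 habc) (neg_nonneg.2 hp)]
  · nlinarith [mul_nonneg (sub_nonneg.2 hb) (sub_nonneg.2 h1),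
      mul_nonneg (sub_nonneg.2 hab) (sub_nonneg.2 h3),
      mul_nonneg (sub_nonneg.2 habc) (neg_nonneg.2 hr),
      mul_nonneg (sub_nonneg.2 hc) (sub_nonneg.2 h2),
      mul_nonneg (sub_nonneg.2 hbc) (sub_nonneg.2 h1),
      mul_nonneg (sub_nonneg.2 habc) (neg_nonneg.2 hp)]
  · nlinarith [mul_nonneg (sub_nonneg.2 hc) (sub_nonneg.2 h2),
      mul_nonneg (sub_nonneg.2 hbc) (sub_nonneg.2 h1),
      mul_nonneg (sub_nonneg.2 habc) (neg_nonneg.2 hp)]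

theorem abs_log_one_sub_sub_le {v : ℝ} (h : |v| < 1) :
    |Real.log (1 - v) - if 0 < v then Real.log (1 - |v|) else 0| ≤ Real.log 3 := by
  have h3 : 0 ≤ Real.log 3 := Real.log_nonneg (by norm_num)
  obtain ⟨h1, h2⟩ := abs_lt.1 h
  split_ifs with hv
  · simpa [abs_of_pos hv] using h3
  · rw [sub_zero, abs_of_nonneg (Real.log_nonneg (by linarith))]
    exact Real.log_le_log (by linarith) (by linarith)

theorem mul_log_le_of_abs_sub_le {B w m c : ℝ} (h : |w - m| ≤ c) : B * w ≤ B * m + |B| * c := by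
  have := mul_le_mul_of_nonneg_left h (abs_nonneg B)
  rw [← abs_mul] at this
  linarith [le_abs_self (B * (w - m))]

theorem abs_log_sub_log_le {v m : ℝ} (hm : 0 < m) (h1 : m ≤ v) (h2 : v ≤ 3 * m) :
    |Real.log v - Real.log m| ≤ Real.log 3 := by
  rw [abs_of_nonneg (sub_nonneg.2 (Real.log_le_log hm h1)), sub_le_iff_le_add,
    ← Real.log_mul (by norm_num) hm.ne']
  exact Real.log_le_log (by linarith) h2

/-- The linear factors of the Koba-Nielsen integrand. -/
def kobaNielsenFactor (x : Fin 3 → ℝ) : Fin 9 → ℝ :=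
  ![x 0, x 1, x 2, 1 - x 0, 1 - x 1, 1 - x 2, x 0 - x 1, x 0 - x 2, x 1 - x 2]

/-- The absolute value of the Koba-Nielsen integrand, for real exponents, written as an
exponential. -/
noncomputable def kobaNielsenWeight (σ : Fin 9 → ℝ) (x : Fin 3 → ℝ) : ℝ :=
  Real.exp (∑ i, σ i * Real.log (kobaNielsenFactor x i))

/-- The set of real parts of the points of `KN6region`. -/
def KN6realRegion : Set (Fin 9 → ℝ) :=
  {σ | (∀ i, -1 < σ i) ∧
       -3 < σ 0 + σ 1 + σ 2 + σ 6 + σ 7 + σ 8 ∧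
       -3 < σ 3 + σ 4 + σ 5 + σ 6 + σ 7 + σ 8 ∧
       -2 < σ 0 + σ 1 + σ 6 ∧
       -2 < σ 0 + σ 2 + σ 7 ∧
       -2 < σ 1 + σ 2 + σ 8 ∧
       -2 < σ 3 + σ 4 + σ 6 ∧
       -2 < σ 3 + σ 5 + σ 7 ∧
       -2 < σ 4 + σ 5 + σ 8 ∧
       -2 < σ 6 + σ 7 + σ 8 ∧
       σ 0 + σ 3 + σ 6 + σ 7 < -1 ∧
       σ 1 + σ 4 + σ 6 + σ 8 < -1 ∧
       σ 2 + σ 5 + σ 7 + σ 8 < -1 ∧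
       σ 0 + σ 3 + σ 1 + σ 4 + σ 6 + σ 7 + σ 8 < -2 ∧
       σ 0 + σ 3 + σ 2 + σ 5 + σ 6 + σ 7 + σ 8 < -2 ∧
       σ 1 + σ 4 + σ 2 + σ 5 + σ 6 + σ 7 + σ 8 < -2 ∧
       (∑ i, σ i) < -3}

theorem sum_univ_fin_nine {M : Type*} [AddCommMonoid M] (f : Fin 9 → M) :
    ∑ i, f i = f 0 + f 1 + f 2 + f 3 + f 4 + f 5 + f 6 + f 7 + f 8 := by
  rw [Fin.sum_univ_castSucc, Fin.sum_univ_eight]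
  rfl

theorem abs_log_one_sub_mul_sub_le {z t : ℝ} (hz : |z| < 1) (ht : |t| < 1) :
    |Real.log (1 - z * t) -
      if 0 < z * t then max (Real.log (1 - |z|)) (Real.log (1 - |t|)) else 0| ≤ Real.log 3 := by
  have hz0 := abs_nonneg z
  have ht0 := abs_nonneg t
  split_ifs with h
  · rw [← abs_of_pos h, abs_mul]
    rcases le_total |z| |t| with hzt | hzt
    · rw [max_eq_left (Real.log_le_log (by linarith) (by linarith))]
      exact abs_log_sub_log_le (by linarith) (by nlinarith) (by nlinarith)
    · rw [max_eq_right (Real.log_le_log (by linarith) (by linarith))]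
      exact abs_log_sub_log_le (by linarith) (by nlinarith) (by nlinarith)
  · have h1 : |z * t| < 1 := by rw [abs_mul]; nlinarith
    simpa [h] using abs_log_one_sub_sub_le h1

theorem abs_log_one_sub_mul_mul_sub_le {z t u : ℝ} (hz : |z| < 1) (ht : |t| < 1) (hu : |u| < 1) :
    |Real.log (1 - z * t * u) - if 0 < z * t * u then
      max (Real.log (1 - |z|)) (max (Real.log (1 - |t|)) (Real.log (1 - |u|))) else 0| ≤
      Real.log 3 := by
  have hz0 := abs_nonneg z
  have ht0 := abs_nonneg t
  have hu0 := abs_nonneg u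
  split_ifs with h
  · have hmono : MonotoneOn Real.log (Set.Ioi 0) := Real.strictMonoOn_log.monotoneOn
    rw [← hmono.map_max (by simpa using ht) (by simpa using hu), ← hmono.map_max (by simpa using hz)
      (by simp [ht]), ← abs_of_pos h, abs_mul, abs_mul]
    have htu := mul_nonneg ht0 hu0
    have hzt := mul_nonneg hz0 ht0
    have hzu := mul_nonneg hz0 hu0
    apply abs_log_sub_log_le
    · simp [hz]
    · refine max_le ?_ (max_le ?_ ?_)
      · nlinarith [mul_nonneg hz0 (sub_nonneg.2 (mul_le_one₀ ht.le hu0 hu.le))]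
      · nlinarith [mul_nonneg ht0 (sub_nonneg.2 (mul_le_one₀ hz.le hu0 hu.le))]
      · nlinarith [mul_nonneg hu0 (sub_nonneg.2 (mul_le_one₀ hz.le ht0 ht.le))]
    · have h1 : 1 - |z| ≤ max (1 - |z|) (max (1 - |t|) (1 - |u|)) := le_max_left _ _
      have h2 : 1 - |t| ≤ max (1 - |z|) (max (1 - |t|) (1 - |u|)) :=
        (le_max_left _ _).trans (le_max_right _ _)
      have h3 : 1 - |u| ≤ max (1 - |z|) (max (1 - |t|) (1 - |u|)) :=
        (le_max_right _ _).trans (le_max_right _ _)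
      nlinarith [mul_nonneg (sub_nonneg.2 hz.le) (sub_nonneg.2 ht.le),
        mul_nonneg hzt (sub_nonneg.2 hu.le)]
  · have h1 : |z * t * u| < 1 := by
      rw [abs_mul, abs_mul]
      nlinarith [mul_nonneg hz0 ht0]
    simpa [h] using abs_log_one_sub_sub_le h1

theorem log_mul_mul_sub {v w : ℝ} (hv : v ≠ 0) (hw : w ≠ 1) :
    Real.log (v * w - v) = Real.log v + Real.log (1 - w) := by
  rw [← Real.log_mul hv (sub_ne_zero.2 hw.symm), ← Real.log_neg_eq_log]
  congr 1
  ring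

theorem sign_pattern_exponent_bounds {a b c B₁ B₂ B₃ d z t u : ℝ} (hz : z ≠ 0) (ht : t ≠ 0)
    (hu : u ≠ 0) (hd : d ≤ 0) (ha : d ≤ a) (hb : d ≤ b) (hc : d ≤ c) (h₁ : d ≤ B₁) (h₂ : d ≤ B₂)
    (h₃ : d ≤ B₃) (hab : 2 * d ≤ a + b + B₁) (hbc : 2 * d ≤ b + c + B₂)
    (habc : 3 * d ≤ a + b + c + B₁ + B₂ + B₃) :
    (d ≤ if 0 < z then a else 0) ∧ (d ≤ if 0 < t then b else 0) ∧
    (d ≤ if 0 < u then c else 0) ∧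
    (2 * d ≤ (if 0 < z then a else 0) + (if 0 < t then b else 0) + if 0 < z * t then B₁ else 0) ∧
    (2 * d ≤ (if 0 < t then b else 0) + (if 0 < u then c else 0) + if 0 < t * u then B₂ else 0) ∧
    (3 * d ≤ (if 0 < z then a else 0) + (if 0 < t then b else 0) + (if 0 < u then c else 0) +
      (if 0 < z * t then B₁ else 0) + (if 0 < t * u then B₂ else 0) +
      if 0 < z * t * u then B₃ else 0) := by
  rcases lt_or_gt_of_ne hz with hz' | hz' <;> rcases lt_or_gt_of_ne ht with ht' | ht' <;>
  rcases lt_or_gt_of_ne hu with hu' | hu' <;>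
  simp only [hz', ht', hu', hz'.not_gt, ht'.not_gt, hu'.not_gt, mul_pos_iff, mul_neg_iff,
    and_true, and_false, or_false, false_or, or_self, if_true,
    if_false] <;>
  refine ⟨?_, ?_, ?_, ?_, ?_, ?_⟩ <;> linarith

theorem exists_log_kobaNielsenWeight_le {σ : Fin 9 → ℝ} (hσ : σ ∈ KN6realRegion) :
    ∃ δ > 0, ∃ C : ℝ, ∀ z t u : ℝ, z ≠ 0 → t ≠ 0 → u ≠ 0 → |z| < 1 → |t| < 1 → |u| < 1 →
      2 * Real.log z + Real.log t +
        ∑ i, σ i * Real.log (kobaNielsenFactor ![z * t * u, z * t, z] i) ≤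
      C + ((δ - 1) * (Real.log z + Real.log (1 - |z|)) +
        (δ - 1) * (Real.log t + Real.log (1 - |t|)) +
        (δ - 1) * (Real.log u + Real.log (1 - |u|))) := by
  obtain ⟨h0, h1, h2, h3, -, -, -, -, h8, h9, -⟩ := hσ
  have key : ∀ c : ℝ, 0 < c → ∀ᶠ δ : ℝ in nhdsWithin 0 (Set.Ioi 0), δ < c := fun c hc =>
    nhdsWithin_le_nhds (Iio_mem_nhds hc)
  have hpos : ∀ᶠ δ : ℝ in nhdsWithin 0 (Set.Ioi 0), 0 < δ := self_mem_nhdsWithin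
  obtain ⟨δ, hδ, e0, e3, e4, e5, e6, e7, e8, k1, k2, k3, k8, k9, k10⟩ :=
    (hpos.and <| (key (σ 0 + 1) (by linarith [h0 0])).and <|
    (key (σ 3 + 1) (by linarith [h0 3])).and <|
    (key (σ 4 + 1) (by linarith [h0 4])).and <|
    (key (σ 5 + 1) (by linarith [h0 5])).and <|
    (key (σ 6 + 1) (by linarith [h0 6])).and <|
    (key (σ 7 + 1) (by linarith [h0 7])).and <|
    (key (σ 8 + 1) (by linarith [h0 8])).and <|
    (key (σ 0 + σ 1 + σ 2 + σ 6 + σ 7 + σ 8 + 3) (by linarith)).and <|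
    (key ((σ 3 + σ 4 + σ 5 + σ 6 + σ 7 + σ 8 + 3) / 3) (by linarith)).and <|
    (key (σ 0 + σ 1 + σ 6 + 2) (by linarith)).and <|
    (key ((σ 4 + σ 5 + σ 8 + 2) / 2) (by linarith)).and
    ((key ((σ 6 + σ 7 + σ 8 + 2) / 2) (by linarith)).and (key 1 one_pos))).exists
  refine ⟨δ, hδ, (|σ 3| + |σ 4| + |σ 5| + |σ 6| + |σ 7| + |σ 8|) * Real.log 3, ?_⟩
  intro z t u hz0 ht0 hu0 hz ht hu
  have nz : z ≠ 1 := fun h => by simp [h] at hz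
  have nt : t ≠ 1 := fun h => by simp [h] at ht
  have nu : u ≠ 1 := fun h => by simp [h] at hu
  have ntu : t * u ≠ 1 := fun h => by
    have := abs_mul t u
    rw [h, abs_one] at this
    nlinarith [abs_nonneg t, abs_nonneg u]
  rw [sum_univ_fin_nine]
  have l6 := log_mul_mul_sub (mul_ne_zero hz0 ht0) nu
  have l7 := log_mul_mul_sub hz0 ntu
  have l8 := log_mul_mul_sub hz0 nt
  rw [← mul_assoc] at l7
  simp only [kobaNielsenFactor, Matrix.cons_val, l6, l7, l8]
  rw [Real.log_mul (mul_ne_zero hz0 ht0) hu0, Real.log_mul hz0 ht0]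
  have m3 := mul_log_le_of_abs_sub_le (B := σ 3) (abs_log_one_sub_mul_mul_sub_le hz ht hu)
  have m4 := mul_log_le_of_abs_sub_le (B := σ 4) (abs_log_one_sub_mul_sub_le hz ht)
  have m5 := mul_log_le_of_abs_sub_le (B := σ 5) (abs_log_one_sub_sub_le hz)
  have m6 := mul_log_le_of_abs_sub_le (B := σ 6) (abs_log_one_sub_sub_le hu)
  have m7 := mul_log_le_of_abs_sub_le (B := σ 7) (abs_log_one_sub_mul_sub_le ht hu)
  have m8 := mul_log_le_of_abs_sub_le (B := σ 8) (abs_log_one_sub_sub_le ht)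
  have logneg : ∀ {v : ℝ}, v ≠ 0 → |v| < 1 → Real.log v ≤ 0 ∧ Real.log (1 - |v|) ≤ 0 :=
    fun {v} hv hv1 => ⟨by
      rw [← Real.log_abs]; exact Real.log_nonpos (abs_nonneg v) hv1.le,
      Real.log_nonpos (by linarith) (by linarith [abs_nonneg v])⟩
  obtain ⟨Z, P⟩ := logneg hz0 hz
  obtain ⟨T, Q⟩ := logneg ht0 ht
  obtain ⟨U, R⟩ := logneg hu0 hu
  have main : σ 3 * (if 0 < z * t * u then
        max (Real.log (1 - |z|)) (max (Real.log (1 - |t|)) (Real.log (1 - |u|))) else 0) +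
      σ 4 * (if 0 < z * t then max (Real.log (1 - |z|)) (Real.log (1 - |t|)) else 0) +
      σ 5 * (if 0 < z then Real.log (1 - |z|) else 0) +
      σ 6 * (if 0 < u then Real.log (1 - |u|) else 0) +
      σ 7 * (if 0 < t * u then max (Real.log (1 - |t|)) (Real.log (1 - |u|)) else 0) +
      σ 8 * (if 0 < t then Real.log (1 - |t|) else 0) ≤
      (δ - 1) * (Real.log (1 - |z|) + Real.log (1 - |t|) + Real.log (1 - |u|)) := by
    obtain ⟨ca, cb, cc, cab, cbc, cabc⟩ := sign_pattern_exponent_bounds (a := σ 5) (b := σ 8)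
      (c := σ 6) (B₁ := σ 4) (B₂ := σ 7) (B₃ := σ 3) (d := δ - 1) hz0 ht0 hu0 (by linarith)
      (by linarith) (by linarith) (by linarith) (by linarith) (by linarith) (by linarith)
      (by linarith) (by linarith) (by linarith)
    have h := log_max_combination_le P Q R ca cb cc cab cbc cabc
    simp only [ite_mul, zero_mul] at h
    simp only [mul_ite, mul_zero]
    linarith
  linarith [mul_nonneg (neg_nonneg.2 Z) (sub_nonneg.2 k1.le),
    mul_nonneg (neg_nonneg.2 T) (sub_nonneg.2 k3.le),
    mul_nonneg (neg_nonneg.2 U) (sub_nonneg.2 e0.le)]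

theorem measurable_kobaNielsenFactor (i : Fin 9) :
    Measurable fun x : Fin 3 → ℝ => kobaNielsenFactor x i := by
  fin_cases i <;> simp only [kobaNielsenFactor] <;> fun_prop

theorem measurable_kobaNielsenWeight (σ : Fin 9 → ℝ) : Measurable (kobaNielsenWeight σ) :=
  Real.measurable_exp.comp <| Finset.measurable_sum _ fun i _ =>
    (Real.measurable_log.comp (measurable_kobaNielsenFactor i)).const_mul _

theorem lintegral_fin_three {g : (Fin 3 → ℝ) → ENNReal} (hg : Measurable g) :
    ∫⁻ x, g x = ∫⁻ z, ∫⁻ y, ∫⁻ x, g ![x, y, z] := by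
  have h3 := (volume_preserving_piFinSuccAbove (fun _ : Fin 3 => ℝ) 2).symm
  rw [← h3.lintegral_comp hg, Measure.volume_eq_prod, lintegral_prod _ (by fun_prop)]
  refine lintegral_congr fun z => ?_
  have h2 := (volume_preserving_piFinSuccAbove (fun _ : Fin 2 => ℝ) 1).symm
  rw [← h2.lintegral_comp (by fun_prop), Measure.volume_eq_prod, lintegral_prod _ (by fun_prop)]
  refine lintegral_congr fun y => ?_
  have h1 := (volume_preserving_funUnique (Fin 1) ℝ).symm
  refine (h1.lintegral_comp (by fun_prop)).symm.trans (lintegral_congr fun x => congrArg g ?_)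
  ext i
  fin_cases i <;> rfl

theorem lintegral_comp_mul_left_real {c : ℝ} (hc : c ≠ 0) (f : ℝ → ENNReal) :
    ∫⁻ x, f x = ∫⁻ x, ENNReal.ofReal |c| * f (c * x) := by
  have hm : MeasurableEmbedding (c * ·) := (Homeomorph.mulLeft₀ c hc).measurableEmbedding
  conv_lhs => rw [← Real.smul_map_volume_mul_left hc]
  rw [lintegral_smul_measure, hm.lintegral_map, smul_eq_mul,
    lintegral_const_mul' _ _ ENNReal.ofReal_ne_top]

theorem lintegral_comp_inv_real (f : ℝ → ENNReal) :
    ∫⁻ x, f x = ∫⁻ x, ENNReal.ofReal |(x ^ 2)⁻¹| * f x⁻¹ := by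
  have hs : MeasurableSet ({0}ᶜ : Set ℝ) := (measurableSet_singleton 0).compl
  have h := lintegral_image_eq_lintegral_abs_deriv_mul hs
    (f := fun x : ℝ => x⁻¹) (f' := fun x => -(x ^ 2)⁻¹)
    (fun x hx => (hasDerivAt_inv hx).hasDerivWithinAt) inv_injective.injOn f
  have him : (fun x : ℝ => x⁻¹) '' {0}ᶜ = {0}ᶜ := by
    ext x
    simp
  rw [him, restrict_compl_singleton] at h
  simpa only [abs_neg] using h

theorem lintegral_log_beta_lt_top {δ : ℝ} (hδ : 0 < δ) :
    ∫⁻ v in Set.Icc (-1 : ℝ) 1,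
      ENNReal.ofReal (Real.exp ((δ - 1) * (Real.log v + Real.log (1 - |v|)))) < ⊤ := by
  set f : ℝ → ℝ := fun v => Real.exp ((δ - 1) * (Real.log v + Real.log (1 - |v|)))
  have h01 : IntervalIntegrable f volume 0 1 := by
    have h := (Complex.betaIntegral_convergent (u := δ) (v := δ) (by simpa) (by simpa)).norm
    refine h.congr_ae ?_
    rw [Set.uIoc_of_le zero_le_one]
    rw [← restrict_Ioo_eq_restrict_Ioc]
    refine (ae_restrict_iff' measurableSet_Ioo).2 (Filter.Eventually.of_forall fun v hv => ?_)
    have e1 : (1 - (v : ℂ)) = ((1 - v : ℝ) : ℂ) := by push_cast; rfl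
    have e2 : ((δ : ℂ) - 1) = ((δ - 1 : ℝ) : ℂ) := by push_cast; rfl
    simp only [f]
    rw [norm_mul, e1, e2, Complex.norm_cpow_eq_rpow_re_of_pos hv.1,
      Complex.norm_cpow_eq_rpow_re_of_pos (sub_pos.2 hv.2), Complex.ofReal_re,
      Real.rpow_def_of_pos hv.1, Real.rpow_def_of_pos (sub_pos.2 hv.2), ← Real.exp_add,
      abs_of_pos hv.1]
    ring_nf
  have heven : ∀ v, f (-v) = f v := fun v => by simp [f]
  have h10 : IntervalIntegrable f volume (-1) 0 := by
    have h := (IntervalIntegrable.comp_sub_left h01 0).symm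
    simpa [heven] using h
  have h := (intervalIntegrable_iff_integrableOn_Icc_of_le (by norm_num)).1 (h10.trans h01)
  exact h.lintegral_lt_top

theorem lintegral_fin_three_nested {g : (Fin 3 → ℝ) → ENNReal} (hg : Measurable g) :
    ∫⁻ x, g x =
      ∫⁻ z, ∫⁻ t, ∫⁻ u, ENNReal.ofReal (|z| * |z * t|) * g ![z * t * u, z * t, z] := by
  rw [lintegral_fin_three hg]
  refine lintegral_congr_ae ((Measure.ae_ne volume 0).mono fun z hz => ?_)
  dsimp only
  rw [lintegral_comp_mul_left_real hz]
  refine lintegral_congr_ae ((Measure.ae_ne volume 0).mono fun t ht => ?_)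
  dsimp only
  rw [lintegral_comp_mul_left_real (mul_ne_zero hz ht),
    ← lintegral_const_mul' _ _ ENNReal.ofReal_ne_top]
  refine lintegral_congr fun u => ?_
  rw [ENNReal.ofReal_mul (abs_nonneg z), mul_assoc, mul_assoc]

/-- The part of the unit cube where the coordinates increase in absolute value. -/
def sortedCube : Set (Fin 3 → ℝ) := {x | |x 0| ≤ |x 1| ∧ |x 1| ≤ |x 2| ∧ |x 2| ≤ 1}

theorem measurableSet_sortedCube : MeasurableSet sortedCube := by
  have h : ∀ i j, MeasurableSet {x : Fin 3 → ℝ | |x i| ≤ |x j|} := fun i j =>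
    measurableSet_le (by fun_prop) (by fun_prop)
  have h1 : MeasurableSet {x : Fin 3 → ℝ | |x 2| ≤ 1} :=
    measurableSet_le (by fun_prop) (by fun_prop)
  exact (h 0 1).inter ((h 1 2).inter h1)

theorem setLIntegral_sortedCube_kobaNielsenWeight_lt_top {σ : Fin 9 → ℝ}
    (hσ : σ ∈ KN6realRegion) :
    ∫⁻ x in sortedCube, ENNReal.ofReal (kobaNielsenWeight σ x) < ⊤ := by
  obtain ⟨δ, hδ, C, hC⟩ := exists_log_kobaNielsenWeight_le hσ
  set f : ℝ → ℝ := fun v => (δ - 1) * (Real.log v + Real.log (1 - |v|))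
  set φ : ℝ → ENNReal := (Set.Icc (-1) 1).indicator fun v => ENNReal.ofReal (Real.exp (f v))
  have hφ : ∫⁻ v, φ v < ⊤ := by
    rw [lintegral_indicator measurableSet_Icc]
    exact lintegral_log_beta_lt_top hδ
  have hφm : Measurable φ := Measurable.indicator (by fun_prop) measurableSet_Icc
  have hw := measurable_kobaNielsenWeight σ
  rw [← lintegral_indicator measurableSet_sortedCube, lintegral_fin_three_nested
    (Measurable.indicator (by fun_prop) measurableSet_sortedCube)]
  have hne : ∀ᵐ v : ℝ, v ≠ 0 ∧ v ≠ 1 ∧ v ≠ -1 :=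
    (Measure.ae_ne volume 0).and ((Measure.ae_ne volume 1).and (Measure.ae_ne volume (-1)))
  calc _ ≤ ∫⁻ z, ∫⁻ t, ∫⁻ u, ENNReal.ofReal (Real.exp C) * φ z * φ t * φ u := by
        refine lintegral_mono_ae (hne.mono fun z hz => ?_)
        refine lintegral_mono_ae (hne.mono fun t ht => ?_)
        refine lintegral_mono_ae (hne.mono fun u hu => ?_)
        by_cases hmem : ![z * t * u, z * t, z] ∈ sortedCube
        · rw [Set.indicator_of_mem hmem]
          have lt : ∀ {v : ℝ}, v ≠ 0 ∧ v ≠ 1 ∧ v ≠ -1 → |v| ≤ 1 → |v| < 1 := fun {v} hv h =>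
            h.lt_of_ne fun h => by
              rcases eq_or_eq_neg_of_abs_eq h with h | h
              exacts [hv.2.1 h, hv.2.2 h]
          have hz0 := abs_pos.2 hz.1
          have ht0 := abs_pos.2 ht.1
          obtain ⟨h1, h2, h3⟩ := hmem
          simp only [Matrix.cons_val, abs_mul] at h1 h2 h3
          have hz1 := lt hz h3
          have ht1 := lt ht (le_of_mul_le_mul_left (by linarith) hz0)
          have hu1 := lt hu (le_of_mul_le_mul_left (by linarith) (mul_pos hz0 ht0))
          have hφe : ∀ {v : ℝ}, |v| < 1 → φ v = ENNReal.ofReal (Real.exp (f v)) := fun h =>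
            Set.indicator_of_mem (Set.mem_Icc.2 (abs_le.1 h.le)) _
          rw [hφe hz1, hφe ht1, hφe hu1, ← ENNReal.ofReal_mul (by positivity),
            ← ENNReal.ofReal_mul (by positivity),
            ← ENNReal.ofReal_mul (by positivity), ← ENNReal.ofReal_mul (by positivity)]
          refine ENNReal.ofReal_le_ofReal ?_
          rw [kobaNielsenWeight, ← Real.exp_log_eq_abs hz.1,
            ← Real.exp_log_eq_abs (mul_ne_zero hz.1 ht.1), Real.log_mul hz.1 ht.1]
          simp only [← Real.exp_add]
          refine Real.exp_le_exp.2 ?_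
          linarith [hC z t u hz.1 ht.1 hu.1 hz1 ht1 hu1]
        · simp [Set.indicator_of_notMem hmem]
    _ = ENNReal.ofReal (Real.exp C) * (∫⁻ v, φ v) * (∫⁻ v, φ v) * (∫⁻ v, φ v) := by
        simp only [lintegral_const_mul _ hφm, lintegral_mul_const _ (hφm.const_mul _),
          lintegral_mul_const _ ((hφm.const_mul _).mul_const _)]
    _ < ⊤ := by finiteness

theorem ae_kobaNielsenFactor_ne_zero : ∀ᵐ x : Fin 3 → ℝ, ∀ i, kobaNielsenFactor x i ≠ 0 := by
  have h1 : ∀ (i : Fin 3) (a : ℝ), ∀ᵐ x : Fin 3 → ℝ, x i ≠ a := fun i a => by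
    have h : volume {x : Fin 3 → ℝ | x i = a} = 0 :=
      Measure.pi_hyperplane (α := fun _ => ℝ) (fun _ => volume) i a
    exact measure_eq_zero_iff_ae_notMem.1 h
  have h2 : ∀ i j : Fin 3, i ≠ j → ∀ᵐ x : Fin 3 → ℝ, x i - x j ≠ 0 := fun i j hij => by
    let p := LinearMap.proj (R := ℝ) (φ := fun _ : Fin 3 => ℝ)
    let L := p i - p j
    refine measure_eq_zero_iff_ae_notMem.1 (Measure.addHaar_submodule volume L.ker fun h => ?_)
    have : Pi.single i 1 ∈ L.ker := h ▸ Submodule.mem_top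
    simp [L, p, hij] at this
  filter_upwards [h1 0 0, h1 1 0, h1 2 0, h1 0 1, h1 1 1, h1 2 1, h2 0 1 (by decide),
    h2 0 2 (by decide), h2 1 2 (by decide)] with x h0 h1 h2 h3 h4 h5 h6 h7 h8 i
  fin_cases i
  exacts [h0, h1, h2, sub_ne_zero.2 h3.symm, sub_ne_zero.2 h4.symm, sub_ne_zero.2 h5.symm,
    h6, h7, h8]

/-- All Koba-Nielsen weights with exponents in `KN6realRegion` have finite integral on `S`. -/
def KobaNielsenFinite (S : Set (Fin 3 → ℝ)) : Prop :=
  ∀ σ ∈ KN6realRegion, ∫⁻ x in S, ENNReal.ofReal (kobaNielsenWeight σ x) < ⊤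

namespace KobaNielsenFinite

variable {S T : Set (Fin 3 → ℝ)}

theorem mono (hT : KobaNielsenFinite T) (h : S ⊆ T) : KobaNielsenFinite S := fun σ hσ =>
  (lintegral_mono_set h).trans_lt (hT σ hσ)

theorem union (hS : KobaNielsenFinite S) (hT : KobaNielsenFinite T) :
    KobaNielsenFinite (S ∪ T) := fun σ hσ =>
  (lintegral_union_le _ S T).trans_lt (ENNReal.add_lt_top.2 ⟨hS σ hσ, hT σ hσ⟩)

theorem preimage_comp_perm (hS : KobaNielsenFinite S) (e : Equiv.Perm (Fin 3))
    (he : ∀ σ ∈ KN6realRegion, ∃ τ ∈ KN6realRegion,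
      ∀ x, kobaNielsenWeight τ (x ∘ e) = kobaNielsenWeight σ x) :
    KobaNielsenFinite {x | x ∘ e ∈ S} := fun σ hσ => by
  obtain ⟨τ, hτ, hw⟩ := he σ hσ
  have hp := volume_measurePreserving_piCongrLeft (fun _ : Fin 3 => ℝ) e.symm
  have hcomp : ∀ x : Fin 3 → ℝ, MeasurableEquiv.piCongrLeft (fun _ => ℝ) e.symm x = x ∘ e :=
    fun x => funext fun i => by
      obtain ⟨j, rfl⟩ := e.symm.surjective i
      rw [MeasurableEquiv.coe_piCongrLeft, Equiv.piCongrLeft_apply_apply]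
      simp
  have h := hp.setLIntegral_comp_preimage_emb (MeasurableEquiv.measurableEmbedding _)
    (fun x => ENNReal.ofReal (kobaNielsenWeight τ x)) S
  simp only [hcomp, Set.preimage, hw] at h
  exact h.trans_lt (hS _ hτ)

theorem preimage_swap_zero_one (hS : KobaNielsenFinite S) :
    KobaNielsenFinite {x | ![x 1, x 0, x 2] ∈ S} := by
  have hcomp : ∀ x : Fin 3 → ℝ, x ∘ Equiv.swap 0 1 = ![x 1, x 0, x 2] := fun x => by
    ext i; fin_cases i <;> rfl
  have h := hS.preimage_comp_perm (Equiv.swap 0 1) fun σ hσ =>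
    ⟨![σ 1, σ 0, σ 2, σ 4, σ 3, σ 5, σ 6, σ 8, σ 7], ?_, fun x => ?_⟩
  · simpa only [hcomp] using h
  · obtain ⟨h0, h⟩ := hσ
    rw [sum_univ_fin_nine] at h
    refine ⟨fun i => by fin_cases i <;> exact h0 _, ?_⟩
    rw [sum_univ_fin_nine]
    simp only [Matrix.cons_val]
    refine ⟨?_, ?_, ?_, ?_, ?_, ?_, ?_, ?_, ?_, ?_, ?_, ?_, ?_, ?_, ?_, ?_⟩ <;> linarith
  · rw [hcomp, kobaNielsenWeight, kobaNielsenWeight, sum_univ_fin_nine, sum_univ_fin_nine]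
    simp only [kobaNielsenFactor, Matrix.cons_val]
    rw [← neg_sub (x 0) (x 1), Real.log_neg_eq_log]
    ring_nf

theorem preimage_swap_one_two (hS : KobaNielsenFinite S) :
    KobaNielsenFinite {x | ![x 0, x 2, x 1] ∈ S} := by
  have hcomp : ∀ x : Fin 3 → ℝ, x ∘ Equiv.swap 1 2 = ![x 0, x 2, x 1] := fun x => by
    ext i; fin_cases i <;> rfl
  have h := hS.preimage_comp_perm (Equiv.swap 1 2) fun σ hσ =>
    ⟨![σ 0, σ 2, σ 1, σ 3, σ 5, σ 4, σ 7, σ 6, σ 8], ?_, fun x => ?_⟩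
  · simpa only [hcomp] using h
  · obtain ⟨h0, h⟩ := hσ
    rw [sum_univ_fin_nine] at h
    refine ⟨fun i => by fin_cases i <;> exact h0 _, ?_⟩
    rw [sum_univ_fin_nine]
    simp only [Matrix.cons_val]
    refine ⟨?_, ?_, ?_, ?_, ?_, ?_, ?_, ?_, ?_, ?_, ?_, ?_, ?_, ?_, ?_, ?_⟩ <;> linarith
  · rw [hcomp, kobaNielsenWeight, kobaNielsenWeight, sum_univ_fin_nine, sum_univ_fin_nine]
    simp only [kobaNielsenFactor, Matrix.cons_val]
    rw [← neg_sub (x 1) (x 2), Real.log_neg_eq_log]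
    ring_nf

end KobaNielsenFinite

theorem kobaNielsenFinite_sortedCube : KobaNielsenFinite sortedCube := fun _ =>
  setLIntegral_sortedCube_kobaNielsenWeight_lt_top

theorem kobaNielsenFinite_cube : KobaNielsenFinite {x | ∀ i, |x i| ≤ 1} := by
  have h := kobaNielsenFinite_sortedCube
  refine (((h.union h.preimage_swap_zero_one).union
    (h.union h.preimage_swap_zero_one).preimage_swap_one_two).union
    ((h.union h.preimage_swap_zero_one).preimage_swap_one_two).preimage_swap_zero_one).mono
    fun x hx => ?_
  have h0 := hx 0
  have h1 := hx 1
  have h2 := hx 2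
  simp only [sortedCube, Set.mem_union, Set.mem_ofPred_eq, Matrix.cons_val]
  rcases le_total |x 0| |x 1| with a | a <;> rcases le_total |x 1| |x 2| with b | b <;>
    rcases le_total |x 0| |x 2| with c | c <;> simp [a, b, c, h0, h1, h2]

theorem lintegral_fin_three_inversion {g : (Fin 3 → ℝ) → ENNReal} (hg : Measurable g) :
    ∫⁻ x, g x = ∫⁻ x : Fin 3 → ℝ, ENNReal.ofReal (|(x 2)⁻¹| ^ 4) *
      g ![(x 2)⁻¹ * x 0, (x 2)⁻¹ * x 1, (x 2)⁻¹] := by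
  rw [lintegral_fin_three hg, lintegral_fin_three (by fun_prop), lintegral_comp_inv_real]
  refine lintegral_congr_ae ((Measure.ae_ne volume 0).mono fun z hz => ?_)
  have hz' := inv_ne_zero hz
  dsimp only
  rw [lintegral_comp_mul_left_real hz', ← lintegral_const_mul' _ _ ENNReal.ofReal_ne_top]
  refine lintegral_congr fun y => ?_
  rw [lintegral_comp_mul_left_real hz', ← lintegral_const_mul' _ _ ENNReal.ofReal_ne_top,
    ← lintegral_const_mul' _ _ ENNReal.ofReal_ne_top]
  refine lintegral_congr fun x => ?_
  simp only [Matrix.cons_val]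
  rw [← mul_assoc, ← mul_assoc, ← ENNReal.ofReal_mul (by positivity),
    ← ENNReal.ofReal_mul (by positivity), ← inv_pow, abs_pow]
  ring_nf

/-- The part of space where the last coordinate dominates the others and `1`. -/
def farSector : Set (Fin 3 → ℝ) := {x | |x 0| ≤ |x 2| ∧ |x 1| ≤ |x 2| ∧ 1 ≤ |x 2|}

theorem measurableSet_farSector : MeasurableSet farSector := by
  have h : ∀ i j, MeasurableSet {x : Fin 3 → ℝ | |x i| ≤ |x j|} := fun i j =>
    measurableSet_le (by fun_prop) (by fun_prop)
  have h1 : MeasurableSet {x : Fin 3 → ℝ | 1 ≤ |x 2|} :=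
    measurableSet_le (by fun_prop) (by fun_prop)
  exact (h 0 2).inter ((h 1 2).inter h1)

theorem kobaNielsenFinite_farSector : KobaNielsenFinite farSector := fun σ hσ => by
  set τ : Fin 9 → ℝ :=
    ![σ 0, σ 1, -4 - ∑ i, σ i, σ 7, σ 8, σ 5, σ 6, σ 3, σ 4] with hτ
  have hτmem : τ ∈ KN6realRegion := by
    obtain ⟨h0, h⟩ := hσ
    have h3 := h.2.2.2.2.2.2.2.2.2.2.2.2.2.2.2
    rw [sum_univ_fin_nine] at h
    refine ⟨fun i => ?_, ?_⟩
    · fin_cases i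
      exacts [h0 _, h0 _, show -1 < -4 - ∑ i, σ i by linarith, h0 _, h0 _, h0 _, h0 _, h0 _, h0 _]
    · simp only [hτ, sum_univ_fin_nine, Matrix.cons_val]
      refine ⟨?_, ?_, ?_, ?_, ?_, ?_, ?_, ?_, ?_, ?_, ?_, ?_, ?_, ?_, ?_, ?_⟩ <;>
        linarith [h0 0, h0 1, h0 2, h0 3, h0 4, h0 5, h0 6, h0 7, h0 8]
  have hw := measurable_kobaNielsenWeight σ
  have hcube : MeasurableSet {x : Fin 3 → ℝ | ∀ i, |x i| ≤ 1} := by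
    rw [Set.ofPred_forall]
    exact MeasurableSet.iInter fun i => measurableSet_le (by fun_prop) (by fun_prop)
  rw [← lintegral_indicator measurableSet_farSector, lintegral_fin_three_inversion
    (Measurable.indicator (by fun_prop) measurableSet_farSector)]
  refine lt_of_le_of_lt ?_ (kobaNielsenFinite_cube τ hτmem)
  rw [← lintegral_indicator hcube]
  refine lintegral_mono_ae (ae_kobaNielsenFactor_ne_zero.mono fun x hx => ?_)
  have h2 : x 2 ≠ 0 := hx 2
  by_cases hmem : ![(x 2)⁻¹ * x 0, (x 2)⁻¹ * x 1, (x 2)⁻¹] ∈ farSector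
  · have hmem' : x ∈ {x : Fin 3 → ℝ | ∀ i, |x i| ≤ 1} := by
      obtain ⟨m0, m1, m2⟩ := hmem
      simp only [Matrix.cons_val, abs_mul] at m0 m1 m2
      have hpos : 0 < |(x 2)⁻¹| := abs_pos.2 (inv_ne_zero h2)
      intro i
      fin_cases i
      · exact le_of_mul_le_mul_left (by simpa using m0) hpos
      · exact le_of_mul_le_mul_left (by simpa using m1) hpos
      · rw [abs_inv] at m2
        exact (one_le_inv₀ (abs_pos.2 h2)).1 m2
    rw [Set.indicator_of_mem hmem, Set.indicator_of_mem hmem',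
      ← ENNReal.ofReal_mul (by positivity)]
    refine le_of_eq (congrArg _ ?_)
    have hlog : ∀ a b : ℝ, b ≠ 0 → a = (x 2)⁻¹ * b → Real.log a = Real.log b - Real.log (x 2) := by
      rintro a b hb rfl
      rw [Real.log_mul (inv_ne_zero h2) hb, Real.log_inv]
      ring
    have l0 := hlog _ _ (hx 0) rfl
    have l1 := hlog _ _ (hx 1) rfl
    have l3 := hlog (1 - (x 2)⁻¹ * x 0) _ (neg_ne_zero.2 (hx 7))
      (by simp only [kobaNielsenFactor, Matrix.cons_val]; field_simp; ring)
    have l4 := hlog (1 - (x 2)⁻¹ * x 1) _ (neg_ne_zero.2 (hx 8))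
      (by simp only [kobaNielsenFactor, Matrix.cons_val]; field_simp; ring)
    have l5 := hlog (1 - (x 2)⁻¹) _ (neg_ne_zero.2 (hx 5))
      (by simp only [kobaNielsenFactor, Matrix.cons_val]; field_simp; ring)
    have l6 := hlog ((x 2)⁻¹ * x 0 - (x 2)⁻¹ * x 1) _ (hx 6)
      (by simp only [kobaNielsenFactor, Matrix.cons_val]; ring)
    have l7 := hlog ((x 2)⁻¹ * x 0 - (x 2)⁻¹) _ (neg_ne_zero.2 (hx 3))
      (by simp only [kobaNielsenFactor, Matrix.cons_val]; ring)
    have l8 := hlog ((x 2)⁻¹ * x 1 - (x 2)⁻¹) _ (neg_ne_zero.2 (hx 4))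
      (by simp only [kobaNielsenFactor, Matrix.cons_val]; ring)
    simp only [Real.log_neg_eq_log, kobaNielsenFactor, Matrix.cons_val] at l0 l1 l3 l4 l5 l6 l7 l8
    rw [← Real.exp_log_eq_abs (inv_ne_zero h2), ← Real.exp_nat_mul, kobaNielsenWeight,
      kobaNielsenWeight, ← Real.exp_add, sum_univ_fin_nine, sum_univ_fin_nine]
    simp only [hτ, sum_univ_fin_nine, kobaNielsenFactor, Matrix.cons_val, l0, l1, l3, l4, l5, l6,
      l7, l8, Real.log_inv]
    congr 1
    push_cast
    ring
  · simp [Set.indicator_of_notMem hmem]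

theorem kobaNielsenFinite_univ : KobaNielsenFinite Set.univ := by
  have h := kobaNielsenFinite_farSector
  refine (((kobaNielsenFinite_cube.union h).union h.preimage_swap_one_two).union
    h.preimage_swap_one_two.preimage_swap_zero_one).mono fun x _ => ?_
  have hcube : |x 0| ≤ 1 → |x 1| ≤ 1 → |x 2| ≤ 1 → ∀ i, |x i| ≤ 1 := fun h0 h1 h2 i => by
    fin_cases i
    exacts [h0, h1, h2]
  simp only [farSector, Set.mem_union, Set.mem_ofPred_eq, Matrix.cons_val]
  grind

theorem sum_le_two_div_mul_exp {b δ : ℝ} (hδ : 0 < δ) : b ≤ 2 / δ * Real.exp (δ / 2 * b) := by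
  have h := Real.add_one_le_exp (δ / 2 * b)
  calc b = 2 / δ * (δ / 2 * b) := by field_simp
    _ ≤ _ := by gcongr; linarith

theorem differentiableAt_integral_exp_sum_mul {α ι : Type*} [MeasurableSpace α] [Fintype ι]
    {μ : Measure α} {l : α → ι → ℝ} (hl : Measurable l) {s₀ : ι → ℂ} {δ : ℝ} (hδ : 0 < δ)
    (hint : ∀ σ : ι → ℝ, (∀ i, |σ i - (s₀ i).re| ≤ δ) →
      Integrable (fun a => Real.exp (∑ i, σ i * l a i)) μ) :
    DifferentiableAt ℂ (fun s : ι → ℂ => ∫ a, Complex.exp (∑ i, s i * (l a i : ℂ)) ∂μ) s₀ := by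
  classical
  let L : (ι → ℝ) → (ι → ℂ) →L[ℂ] ℂ := fun v =>
    ∑ i, (v i : ℂ) • ContinuousLinearMap.proj (R := ℂ) (φ := fun _ : ι => ℂ) i
  have hL : ∀ v s, L v s = ∑ i, s i * (v i : ℂ) := fun v s => by
    simp [L, mul_comm]
  have hLnorm : ∀ v, ‖L v‖ ≤ ∑ i, |v i| := fun v => by
    refine ContinuousLinearMap.opNorm_le_bound _ (by positivity) fun s => ?_
    rw [hL, Finset.sum_mul]
    refine (norm_sum_le _ _).trans (Finset.sum_le_sum fun i _ => ?_)
    rw [norm_mul, Complex.norm_real, Real.norm_eq_abs, mul_comm]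
    gcongr
    exact norm_le_pi_norm s i
  have hre : ∀ (v : ι → ℝ) (s : ι → ℂ), (∑ i, s i * (v i : ℂ)).re = ∑ i, (s i).re * v i :=
    fun v s => by simp [Complex.re_sum]
  let corner : (ι → Bool) → ι → ℝ := fun ε i => (s₀ i).re + if ε i then δ else -δ
  have hcorner : ∀ ε i, |corner ε i - (s₀ i).re| ≤ δ := fun ε i => by
    simp only [corner, add_sub_cancel_left]
    split_ifs <;> simp [abs_of_pos hδ]
  let bound : α → ℝ := fun a => 2 / δ * ∑ ε, Real.exp (∑ i, corner ε i * l a i)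
  have hmeas : StronglyMeasurable l := hl.stronglyMeasurable
  refine (hasFDerivAt_integral_of_dominated_of_fderiv_le (𝕜 := ℂ)
    (F := fun s a => Complex.exp (∑ i, s i * (l a i : ℂ)))
    (F' := fun s a => Complex.exp (L (l a) s) • L (l a)) (bound := bound)
    (Metric.ball_mem_nhds s₀ (half_pos hδ)) (Filter.Eventually.of_forall fun s => ?_) ?_ ?_
    (Filter.Eventually.of_forall fun a s hs => ?_) ?_
    (Filter.Eventually.of_forall fun a s _ => ?_)).differentiableAt
  · have hc : Continuous fun v : ι → ℝ => Complex.exp (∑ i, s i * (v i : ℂ)) := by fun_prop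
    exact (hc.comp_stronglyMeasurable hmeas).aestronglyMeasurable
  · have hc : Continuous fun v : ι → ℝ => Complex.exp (∑ i, s₀ i * (v i : ℂ)) := by fun_prop
    refine (hint (fun i => (s₀ i).re) fun i => by simpa using hδ.le).mono'
      (hc.comp_stronglyMeasurable hmeas).aestronglyMeasurable
      (Filter.Eventually.of_forall fun a => ?_)
    rw [Complex.norm_exp, hre]
  · have hc : Continuous fun v : ι → ℝ => Complex.exp (L v s₀) • L v := by
      simp only [hL]
      fun_prop
    exact (hc.comp_stronglyMeasurable hmeas).aestronglyMeasurable
  · have hterm : ∀ i, (s i).re * l a i ≤ (s₀ i).re * l a i + δ / 2 * |l a i| := fun i => by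
      have h1 : |(s i).re - (s₀ i).re| ≤ δ / 2 := by
        rw [← Complex.sub_re, ← Pi.sub_apply]
        exact (Complex.abs_re_le_norm _).trans
          ((norm_le_pi_norm (s - s₀) i).trans (mem_ball_iff_norm.1 hs).le)
      have h2 := mul_le_mul_of_nonneg_right h1 (abs_nonneg (l a i))
      rw [← abs_mul, sub_mul] at h2
      linarith [le_abs_self ((s i).re * l a i - (s₀ i).re * l a i)]
    have hsel : ∀ i, corner (fun i => 0 ≤ l a i) i * l a i =
        (s₀ i).re * l a i + δ * |l a i| := fun i => by
      simp only [corner, decide_eq_true_eq]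
      split_ifs with h
      · rw [abs_of_nonneg h]; ring
      · rw [abs_of_neg (not_le.1 h)]; ring
    calc ‖Complex.exp (L (l a) s) • L (l a)‖
        ≤ Real.exp (∑ i, ((s₀ i).re * l a i + δ / 2 * |l a i|)) *
          (2 / δ * Real.exp (δ / 2 * ∑ i, |l a i|)) := by
          rw [norm_smul, Complex.norm_exp, hL, hre]
          gcongr
          · exact hterm _
          · exact (hLnorm _).trans (sum_le_two_div_mul_exp hδ)
      _ = 2 / δ * Real.exp (∑ i, corner (fun i => 0 ≤ l a i) i * l a i) := by
          rw [mul_left_comm, ← Real.exp_add, Finset.mul_sum, ← Finset.sum_add_distrib]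
          simp only [hsel]
          congr 3
          ext i
          ring
      _ ≤ bound a := by
          refine mul_le_mul_of_nonneg_left ?_ (by positivity)
          exact Finset.single_le_sum (f := fun ε => Real.exp (∑ i, corner ε i * l a i))
            (fun _ _ => (Real.exp_pos _).le) (Finset.mem_univ _)
  · exact (integrable_finsetSum _ fun ε _ => hint _ (hcorner ε)).const_mul _
  · simp only [← hL]
    exact (L (l a)).hasFDerivAt.cexp

theorem integrable_kobaNielsenWeight {σ : Fin 9 → ℝ} (hσ : σ ∈ KN6realRegion) :
    Integrable (kobaNielsenWeight σ) := by
  refine ⟨(measurable_kobaNielsenWeight σ).aestronglyMeasurable, ?_⟩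
  rw [hasFiniteIntegral_iff_ofReal (f := kobaNielsenWeight σ)
    (Filter.Eventually.of_forall fun x => (Real.exp_pos _).le)]
  simpa using kobaNielsenFinite_univ σ hσ

theorem isOpen_KN6realRegion : IsOpen KN6realRegion := by
  unfold KN6realRegion
  simp only [Set.ofPred_and, Set.ofPred_forall]
  repeat' apply IsOpen.inter
  · exact isOpen_iInter_of_finite fun i => isOpen_lt (by fun_prop) (by fun_prop)
  all_goals exact isOpen_lt (by fun_prop) (by fun_prop)

theorem KN6integrand_eq_exp (s : Fin 9 → ℂ) {x : Fin 3 → ℝ}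
    (hx : ∀ i, kobaNielsenFactor x i ≠ 0) :
    KN6integrand s x =
      Complex.exp (∑ i, s i * (Real.log (kobaNielsenFactor x i) : ℂ)) := by
  have h : ∀ i, ((|kobaNielsenFactor x i| : ℝ) : ℂ) ^ s i =
      Complex.exp (s i * (Real.log (kobaNielsenFactor x i) : ℂ)) := fun i => by
    rw [Complex.cpow_def_of_ne_zero (Complex.ofReal_ne_zero.2 (abs_ne_zero.2 (hx i))),
      ← Complex.ofReal_log (abs_nonneg _), Real.log_abs, mul_comm]
  rw [sum_univ_fin_nine]
  simp only [Complex.exp_add, ← h]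
  rfl

/-- The real Koba-Nielsen local zeta function `Z^(6)(s)` converges and is holomorphic on
the region `KN6region`. -/
theorem kobaNielsen_six_points_convergent_and_holomorphic :
    (∀ s ∈ KN6region, Integrable (KN6integrand s)) ∧
    DifferentiableOn ℂ (fun s => ∫ x : Fin 3 → ℝ, KN6integrand s x) KN6region := by
  have hae : ∀ s, KN6integrand s =ᵐ[volume] fun x =>
      Complex.exp (∑ i, s i * (Real.log (kobaNielsenFactor x i) : ℂ)) := fun s =>
    ae_kobaNielsenFactor_ne_zero.mono fun x hx => KN6integrand_eq_exp s hx
  have hlog : Measurable fun x : Fin 3 → ℝ => fun i => Real.log (kobaNielsenFactor x i) :=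
    measurable_pi_lambda _ fun i => Real.measurable_log.comp (measurable_kobaNielsenFactor i)
  refine ⟨fun s hs => ?_, fun s hs => DifferentiableAt.differentiableWithinAt ?_⟩
  · have hc : Continuous fun v : Fin 9 → ℝ => Complex.exp (∑ i, s i * (v i : ℂ)) := by fun_prop
    refine Integrable.congr ?_ (hae s).symm
    refine (integrable_kobaNielsenWeight (σ := fun i => (s i).re) hs).mono'
      (hc.measurable.comp hlog).aestronglyMeasurable (Filter.Eventually.of_forall fun x => ?_)
    simp [Complex.norm_exp, Complex.re_sum, kobaNielsenWeight]
  · obtain ⟨δ, hδ, hball⟩ := Metric.nhds_basis_closedBall.mem_iff.1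
      (isOpen_KN6realRegion.mem_nhds (x := fun i => (s i).re) hs)
    simp only [fun s => integral_congr_ae (hae s)]
    refine differentiableAt_integral_exp_sum_mul hlog hδ fun σ hσ =>
      integrable_kobaNielsenWeight (hball ?_)
    rw [mem_closedBall_iff_norm, pi_norm_le_iff_of_nonneg hδ.le]
    exact hσ
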